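/- arXiv:1309.2754 — 9 statements merged into one kernel-verified Lean document; each statement's English description precedes it below -/
import Mathlib

section
/- Let Λ be a nonzero complex number and s ∈ ℂ with s² = Λ. Define, for every complex t with cosh(t/√2) ≠ 0, q₁(t) := −(i/s)·tanh(t/√2) and p₁(t) := −(i/(√2·s))·cosh(t/√2)⁻². Then for all real parameters m and λ, the curve t ↦ (q₁(t), 0, p₁(t), 0) is a solution of the Hamiltonian system of the FRW Hamiltonian with curvature k = 1: at every such t one has q₁'(t) = p₁(t) and p₁'(t) = −q₁(t) − Λ·q₁(t)³ (the second pair of equations q₂' = p₂, p₂' = −q₂ + m²q₁²q₂ − λq₂³ holding trivially since q₂ ≡ p₂ ≡ 0). -/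
/-- The invariant-plane curve `t ↦ (q₁(t), 0, p₁(t), 0)` with
`q₁(t) = -(i/s)·tanh(t/√2)` and `p₁(t) = -(i/(√2·s))·cosh(t/√2)⁻²` (where `s² = Λ`)
is a solution of the FRW Hamiltonian system with curvature `k = 1`. -/
theorem stmt_0 (Λ s : ℂ) (hΛ : Λ ≠ 0) (hs : s ^ 2 = Λ)
    (q₁ p₁ : ℂ → ℂ)
    (hq : ∀ t : ℂ, q₁ t = -(Complex.I / s) * Complex.tanh (t / (Real.sqrt 2 : ℂ)))
    (hp : ∀ t : ℂ, p₁ t =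
      -(Complex.I / ((Real.sqrt 2 : ℂ) * s)) * (Complex.cosh (t / (Real.sqrt 2 : ℂ)))⁻¹ ^ 2)
    (m lam : ℝ) :
    ∀ t : ℂ, Complex.cosh (t / (Real.sqrt 2 : ℂ)) ≠ 0 →
      HasDerivAt q₁ (p₁ t) t ∧
      HasDerivAt p₁ (-q₁ t - Λ * q₁ t ^ 3 + (m : ℂ) ^ 2 * q₁ t * (0 : ℂ) ^ 2) t ∧
      HasDerivAt (fun _ : ℂ => (0 : ℂ)) (0 : ℂ) t ∧
      HasDerivAt (fun _ : ℂ => (0 : ℂ))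
        (-(0 : ℂ) + (m : ℂ) ^ 2 * q₁ t ^ 2 * (0 : ℂ) - (lam : ℂ) * (0 : ℂ) ^ 3) t := by
  intro t hc
  have hs0 : s ≠ 0 := by
    rintro rfl
    exact hΛ (by simpa using hs.symm)
  have hr : ((Real.sqrt 2 : ℝ) : ℂ) ^ 2 = 2 := by
    rw [← Complex.ofReal_pow, Real.sq_sqrt (by norm_num)]
    norm_num
  rw [hq t, hp t, funext hq, funext hp]
  clear hq hp
  generalize ((Real.sqrt 2 : ℝ) : ℂ) = r at *
  have hr0 : r ≠ 0 := by
    rintro rfl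
    norm_num at hr
  have hd : HasDerivAt (fun t : ℂ => t / r) (1 / r) t := (hasDerivAt_id t).div_const r
  have hS := hd.csinh
  have hC := hd.ccosh
  have hid := Complex.cosh_sq_sub_sinh_sq (t / r)
  have hI : Complex.I ^ 2 = -1 := Complex.I_sq
  refine ⟨?_, ?_, hasDerivAt_const _ _, ?_⟩
  · have h := (hS.fun_div hC hc).const_mul (-(Complex.I / s))
    simp only [Complex.tanh_eq_sinh_div_cosh]
    refine h.congr_deriv (Eq.symm ?_)
    field_simp
    linear_combination hid
  · have h := ((hC.fun_inv hc).fun_pow 2).const_mul (-(Complex.I / (r * s)))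
    refine h.congr_deriv (Eq.symm ?_)
    simp only [Complex.tanh_eq_sinh_div_cosh, ← hs]
    generalize Complex.cosh (t / r) = c at *
    generalize Complex.sinh (t / r) = S at *
    have e : Complex.I ^ 3 = -Complex.I := Complex.I_pow_three
    have h1 : -(-(Complex.I / s) * (S / c)) - s ^ 2 * (-(Complex.I / s) * (S / c)) ^ 3
        = Complex.I * S * (c ^ 2 - S ^ 2) / (s * c ^ 3) := by
      field_simp
      linear_combination S ^ 3 * hI
    have h2 : (-(Complex.I / (r * s))) * (2 * c⁻¹ * (-(S * (1 / r)) / c ^ 2))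
        = Complex.I * S * 2 / (r ^ 2 * s * c ^ 3) := by
      field_simp
    simp only [Nat.cast_ofNat, Nat.add_one_sub_one, pow_one]
    rw [h2, hr]
    linear_combination h1 + Complex.I * S / (s * c ^ 3) * hid
  · simpa using hasDerivAt_const t (0 : ℂ)
end

section
/- For every complex t with cosh(t/√2) ≠ 0, the function f₁(t) := cosh(t/√2)⁻² satisfies the linear second-order differential equation f₁''(t) = (−1 + 3·tanh²(t/√2))·f₁(t). -/
/-- `f₁(t) = cosh(t/√2)⁻²` solves the variational equation
`f₁'' = (-1 + 3·tanh²(t/√2))·f₁` wherever `cosh(t/√2) ≠ 0`. -/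
theorem stmt_3 (f₁ : ℂ → ℂ)
    (hf : ∀ t : ℂ, f₁ t = (Complex.cosh (t / (Real.sqrt 2 : ℂ)))⁻¹ ^ 2) :
    ∀ t : ℂ, Complex.cosh (t / (Real.sqrt 2 : ℂ)) ≠ 0 →
      deriv (deriv f₁) t =
        (-1 + 3 * Complex.tanh (t / (Real.sqrt 2 : ℂ)) ^ 2) * f₁ t := by
  intro t ht
  obtain rfl : f₁ = fun t => (Complex.cosh (t / (Real.sqrt 2 : ℂ)))⁻¹ ^ 2 := funext hf
  have hr : (Real.sqrt 2 : ℂ) ^ 2 = 2 := by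
    norm_cast
    simp
  generalize (Real.sqrt 2 : ℂ) = r at *
  have hr0 : r ≠ 0 := by
    rintro rfl
    norm_num at hr
  have hl : ∀ z : ℂ, HasDerivAt (fun z : ℂ => z / r) (1 / r) z :=
    fun z => (hasDerivAt_id z).div_const r
  have hc : ∀ z : ℂ, HasDerivAt (fun z => Complex.cosh (z / r))
      (Complex.sinh (z / r) * (1 / r)) z := fun z => (hl z).ccosh
  have hs : ∀ z : ℂ, HasDerivAt (fun z => Complex.sinh (z / r))
      (Complex.cosh (z / r) * (1 / r)) z := fun z => (hl z).csinh
  have h1 : ∀ z : ℂ, Complex.cosh (z / r) ≠ 0 →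
      deriv (fun t => (Complex.cosh (t / r))⁻¹ ^ 2) z =
        (-2 / r) * (Complex.sinh (z / r) * (Complex.cosh (z / r))⁻¹ ^ 3) := by
    intro z hz
    refine (((hc z).fun_inv hz).fun_pow 2).deriv.trans ?_
    push_cast
    field_simp
  have hev : deriv (fun t => (Complex.cosh (t / r))⁻¹ ^ 2) =ᶠ[nhds t]
      fun z => (-2 / r) * (Complex.sinh (z / r) * (Complex.cosh (z / r))⁻¹ ^ 3) := by
    filter_upwards [(hc t).continuousAt.eventually_ne ht] with z hz using h1 z hz
  rw [hev.deriv_eq]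
  refine (((hs t).fun_mul (((hc t).fun_inv ht).fun_pow 3)).const_mul (-2 / r)).deriv.trans ?_
  rw [Complex.tanh_eq_sinh_div_cosh]
  push_cast
  field_simp
  rw [hr]
  ring
end

section
/- For every complex t with cosh(t/√2) ≠ 0, the function f₂(t) := (1/8)·(3t·cosh(t/√2)⁻² + √2·(sinh(√2·t) + 3·tanh(t/√2))) satisfies the linear second-order differential equation f₂''(t) = (−1 + 3·tanh²(t/√2))·f₂(t). -/
/-- `f₂(t) = (1/8)·(3t·cosh(t/√2)⁻² + √2·(sinh(√2t) + 3tanh(t/√2)))` solves the variational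
equation `f₂'' = (-1 + 3·tanh²(t/√2))·f₂` wherever `cosh(t/√2) ≠ 0`. -/
theorem stmt_4 (f₂ : ℂ → ℂ)
    (hf : ∀ t : ℂ, f₂ t = (1 / 8) *
      (3 * t * (Complex.cosh (t / (Real.sqrt 2 : ℂ)))⁻¹ ^ 2 +
        (Real.sqrt 2 : ℂ) * (Complex.sinh ((Real.sqrt 2 : ℂ) * t) +
          3 * Complex.tanh (t / (Real.sqrt 2 : ℂ))))) :
    ∀ t : ℂ, Complex.cosh (t / (Real.sqrt 2 : ℂ)) ≠ 0 →
      deriv (deriv f₂) t =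
        (-1 + 3 * Complex.tanh (t / (Real.sqrt 2 : ℂ)) ^ 2) * f₂ t := by
  intro t ht
  obtain ⟨s, hs⟩ : ∃ s : ℂ, s = (Real.sqrt 2 : ℂ) := ⟨_, rfl⟩
  have hs2 : s ^ 2 = 2 := by
    rw [hs, ← Complex.ofReal_pow, Real.sq_sqrt (by norm_num)]; norm_num
  rw [← hs] at hf ht ⊢
  have hs0 : s ≠ 0 := by
    intro h; rw [h] at hs2; norm_num at hs2
  have hC : ∀ u : ℂ, HasDerivAt (fun u => Complex.cosh (u / s)) (Complex.sinh (u / s) * (1 / s)) u :=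
    fun u => ((hasDerivAt_id u).div_const s).ccosh
  have hS : ∀ u : ℂ, HasDerivAt (fun u => Complex.sinh (u / s)) (Complex.cosh (u / s) * (1 / s)) u :=
    fun u => ((hasDerivAt_id u).div_const s).csinh
  have hSS : ∀ u : ℂ, Complex.sinh (s * u) = 2 * Complex.sinh (u / s) * Complex.cosh (u / s) := by
    intro u
    rw [← Complex.sinh_two_mul]
    congr 1
    field_simp
    linear_combination u * hs2
  have hfe : f₂ = fun u => (1 / 8) * (3 * u * (Complex.cosh (u / s))⁻¹ ^ 2 +
      s * (2 * Complex.sinh (u / s) * Complex.cosh (u / s) +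
        3 * (Complex.sinh (u / s) / Complex.cosh (u / s)))) := by
    funext u
    rw [hf, hSS, Complex.tanh_eq_sinh_div_cosh]
  have h1 : ∀ u : ℂ, Complex.cosh (u / s) ≠ 0 → deriv f₂ u =
      (1 / 8) * (6 * (Complex.cosh (u / s))⁻¹ ^ 2
        - 6 / s * (u * Complex.sinh (u / s) * (Complex.cosh (u / s))⁻¹ ^ 3)
        + 2 * (2 * Complex.cosh (u / s) ^ 2 - 1)) := by
    intro u hu
    rw [hfe]
    have h := (((((hasDerivAt_id u).const_mul 3).mul (((hC u).inv hu).pow 2)).add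
      (((((hS u).const_mul 2).mul (hC u)).add
        (((hS u).div (hC u) hu).const_mul 3)).const_mul s)).const_mul (1 / 8))
    refine (h.congr_deriv ?_).deriv
    have e := Complex.cosh_sq (u / s)
    have e' : Complex.sinh (u / s) ^ 2 = Complex.cosh (u / s) ^ 2 - 1 := by rw [e]; ring
    simp only [id, Pi.inv_apply, Pi.pow_apply, Nat.add_one_sub_one, Nat.reduceSub, Nat.cast_ofNat, pow_one]
    generalize Complex.cosh (u / s) = C at *
    generalize Complex.sinh (u / s) = S at *
    field_simp
    ring_nf
    simp only [e']
    ring_nf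
  have hev : deriv f₂ =ᶠ[nhds t] fun u => (1 / 8) * (6 * (Complex.cosh (u / s))⁻¹ ^ 2
        - 6 / s * (u * Complex.sinh (u / s) * (Complex.cosh (u / s))⁻¹ ^ 3)
        + 2 * (2 * Complex.cosh (u / s) ^ 2 - 1)) := by
    filter_upwards [(hC t).continuousAt.eventually_ne ht] with u hu using h1 u hu
  rw [hev.deriv_eq]
  have h := ((((((hC t).inv ht).pow 2).const_mul 6).sub
    ((((hasDerivAt_id t).mul (hS t)).mul (((hC t).inv ht).pow 3)).const_mul (6 / s))).add
    (((((hC t).pow 2).const_mul 2).sub_const 1).const_mul 2)).const_mul (1 / 8)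
  refine (h.congr_deriv (g' := (1 / 8) * (-(18 / s) * Complex.sinh (t / s) * (Complex.cosh (t / s))⁻¹ ^ 3
      - 3 * t * ((Complex.cosh (t / s))⁻¹ ^ 2
        - 3 * Complex.sinh (t / s) ^ 2 * (Complex.cosh (t / s))⁻¹ ^ 4)
      + 8 / s * Complex.sinh (t / s) * Complex.cosh (t / s))) ?_).deriv.trans ?_
  · simp only [id, Pi.inv_apply, Pi.pow_apply, Pi.mul_apply, Nat.reduceSub, Nat.cast_ofNat, pow_one]
    generalize Complex.cosh (t / s) = C at *
    generalize Complex.sinh (t / s) = S at *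
    field_simp
    ring_nf
    simp only [hs2]
    ring_nf
  · rw [hfe, Complex.tanh_eq_sinh_div_cosh]
    have e := Complex.cosh_sq (t / s)
    have e' : Complex.sinh (t / s) ^ 2 = Complex.cosh (t / s) ^ 2 - 1 := by rw [e]; ring
    simp only []
    generalize Complex.cosh (t / s) = C at *
    generalize Complex.sinh (t / s) = S at *
    field_simp
    rw [e']
    linear_combination (-(S * C * (4 * C ^ 4 - 9))) * hs2
end

section
/- Let f₁(t) := cosh(t/√2)⁻² and f₂(t) := (1/8)·(3t·cosh(t/√2)⁻² + √2·(sinh(√2·t) + 3·tanh(t/√2))). Then for every complex t with cosh(t/√2) ≠ 0, the Wronskian satisfies f₁(t)·f₂'(t) − f₂(t)·f₁'(t) = 1. -/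
/-- The Wronskian of the two fundamental solutions `f₁`, `f₂` of the first variational
equation equals `1` wherever `cosh(t/√2) ≠ 0`. -/
theorem stmt_5 (f₁ f₂ : ℂ → ℂ)
    (hf₁ : ∀ t : ℂ, f₁ t = (Complex.cosh (t / (Real.sqrt 2 : ℂ)))⁻¹ ^ 2)
    (hf₂ : ∀ t : ℂ, f₂ t = (1 / 8) *
      (3 * t * (Complex.cosh (t / (Real.sqrt 2 : ℂ)))⁻¹ ^ 2 +
        (Real.sqrt 2 : ℂ) * (Complex.sinh ((Real.sqrt 2 : ℂ) * t) +
          3 * Complex.tanh (t / (Real.sqrt 2 : ℂ))))) :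
    ∀ t : ℂ, Complex.cosh (t / (Real.sqrt 2 : ℂ)) ≠ 0 →
      f₁ t * deriv f₂ t - f₂ t * deriv f₁ t = 1 := by
  intro t hc
  have hr : ((Real.sqrt 2 : ℝ) : ℂ) ^ 2 = 2 := by
    rw [← Complex.ofReal_pow, Real.sq_sqrt (by norm_num)]; norm_num
  generalize ((Real.sqrt 2 : ℝ) : ℂ) = r at *
  have hr0 : r ≠ 0 := by
    rintro rfl
    norm_num at hr
  have hu : HasDerivAt (fun t : ℂ => t / r) (1 / r) t := (hasDerivAt_id t).div_const r
  have hv : HasDerivAt (fun t : ℂ => r * t) (r * 1) t := (hasDerivAt_id t).const_mul r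
  have hC := hu.ccosh
  have hS := hu.csinh
  have h1 := (hC.fun_inv hc).fun_pow 2
  have hT := hS.fun_div hC hc
  have h2 := ((((hasDerivAt_id t).const_mul 3).fun_mul h1).fun_add
    ((hv.csinh.fun_add (hT.const_mul 3)).const_mul r)).const_mul (1 / 8)
  have e1 : f₁ = fun t => (Complex.cosh (t / r))⁻¹ ^ 2 := funext hf₁
  have e2 : f₂ = fun t => (1 / 8) * (3 * id t * (Complex.cosh (t / r))⁻¹ ^ 2 +
        r * (Complex.sinh (r * t) + 3 * (Complex.sinh (t / r) / Complex.cosh (t / r)))) := by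
    funext x
    rw [hf₂, Complex.tanh_eq_sinh_div_cosh, id]
  rw [e1, e2, h1.deriv, h2.deriv]
  have hrt : r * t = 2 * (t / r) := by
    field_simp
    rw [hr]
    ring
  have hcs := Complex.cosh_sq_sub_sinh_sq (t / r)
  simp only [id]
  rw [hrt, Complex.sinh_two_mul, Complex.cosh_two_mul]
  generalize Complex.cosh (t / r) = c at *
  generalize Complex.sinh (t / r) = s at *
  have hs : s ^ 2 = c ^ 2 - 1 := by linear_combination -hcs
  simp only [Nat.cast_ofNat, Nat.add_one_sub_one, Nat.reduceSub, pow_one]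
  field_simp
  ring_nf
  have hr3 : r ^ 3 = 2 * r := by rw [← hr]; ring
  simp only [hr, hr3, hs]
  ring
end

section
/- Let n ≥ 2 be an integer and m a nonzero real number, set Λ := −2m²/((n+1)(n+2)) and ν := √(n(n+3)) (a real number). Then there exists a nonzero complex polynomial A of degree at most n+1 such that the function g : ℝ → ℂ defined by g(t) := cosh(t/√2)^(−ν) · (1 + tanh(t/√2))^(−ν) · A(tanh(t/√2)) (real powers of the positive real numbers cosh(t/√2) and 1 + tanh(t/√2)) is a nonzero solution of the second-order differential equation g''(t) = −(1 + (m²/Λ)·tanh²(t/√2))·g(t) = (−1 + ((n+1)(n+2)/2)·tanh²(t/√2))·g(t) for all t ∈ ℝ. -/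
open Polynomial in
lemma hderiv_aux (ν : ℝ) (P : Polynomial ℂ) (t : ℝ) :
    HasDerivAt (fun t : ℝ => ((Real.exp (-ν * (t / √2)) : ℝ) : ℂ) *
        P.eval ((Real.tanh (t / √2) : ℝ) : ℂ))
      (((Real.exp (-ν * (t / √2)) : ℝ) : ℂ) *
        (C (((1 / √2 : ℝ) : ℂ)) * (C (-(ν : ℂ)) * P + (1 - X ^ 2) * derivative P)).eval
          ((Real.tanh (t / √2) : ℝ) : ℂ)) t := by
  have hs : HasDerivAt (fun t : ℝ => t / √2) (1 / √2) t := (hasDerivAt_id t).div_const _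
  have h1 := ((hs.const_mul (-ν)).exp).ofReal_comp
  have hth : HasDerivAt (fun t : ℝ => Real.tanh (t / √2))
      ((1 - Real.tanh (t / √2) ^ 2) * (1 / √2)) t := by
    have := (hs.sinh).div hs.cosh (Real.cosh_pos _).ne'
    have e : (fun t : ℝ => Real.tanh (t / √2)) =
        (fun t : ℝ => Real.sinh (t / √2)) / (fun t : ℝ => Real.cosh (t / √2)) := by
      funext x; simp [Real.tanh_eq_sinh_div_cosh]
    rw [e]
    refine this.congr_deriv ?_
    rw [Real.tanh_eq_sinh_div_cosh]
    have := (Real.cosh_pos (t / √2)).ne'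
    field_simp
  have h2 := (P.hasDerivAt ((Real.tanh (t / √2) : ℝ) : ℂ)).comp t hth.ofReal_comp
  have h3 := h1.mul h2
  refine h3.congr_deriv ?_
  simp
  ring

noncomputable def acoef (ν : ℝ) (l : ℕ) : ℕ → ℂ
  | 0 => 1
  | k + 1 => ((k : ℂ) * (k + 1) - l * (l + 1)) / (2 * (k + 1) * (k + 1 + ν)) * acoef ν l k

lemma acoef_zero (ν : ℝ) (l : ℕ) (j : ℕ) : acoef ν l (l + 1 + j) = 0 := by
  induction j with
  | zero => simp [acoef]
  | succ j ih => rw [← add_assoc, acoef, ih, mul_zero]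

open Polynomial in
lemma exists_B (ν : ℝ) (hν : 0 ≤ ν) (l : ℕ) : ∃ B : Polynomial ℂ, B.natDegree ≤ l ∧
    B.coeff 0 = 1 ∧ C 2 * (derivative (derivative B) * X) - derivative (derivative B) * X ^ 2
      + C (2 + 2 * (ν : ℂ)) * derivative B - C 2 * (derivative B * X)
      + C ((l : ℂ) * (l + 1)) * B = 0 := by
  let B : Polynomial ℂ := ∑ k ∈ Finset.range (l + 1), C (acoef ν l k) * X ^ k
  have hc : ∀ k, B.coeff k = acoef ν l k := by
    intro k
    simp only [B, finsetSum_coeff, coeff_C_mul, coeff_X_pow]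
    simp only [mul_ite, mul_one, mul_zero, Finset.sum_ite_eq, Finset.mem_range]
    split_ifs with h
    · rfl
    · obtain ⟨j, rfl⟩ := Nat.exists_eq_add_of_le (not_lt.mp h)
      rw [acoef_zero]
  have hrec : ∀ k : ℕ, acoef ν l (k + 1) * (2 * (k + 1) * (k + 1 + ν)) =
      ((k : ℂ) * (k + 1) - l * (l + 1)) * acoef ν l k := by
    intro k
    have h1 : ((k : ℂ) + 1) ≠ 0 := by exact_mod_cast Nat.succ_ne_zero k
    have h2 : ((k : ℂ) + 1 + ν) ≠ 0 := by
      have : (k : ℝ) + 1 + ν ≠ 0 := by positivity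
      exact_mod_cast this
    rw [acoef]
    field_simp
  refine ⟨B, ?_, ?_, ?_⟩
  · rw [natDegree_le_iff_coeff_eq_zero]
    intro k hk
    obtain ⟨j, rfl⟩ := Nat.exists_eq_add_of_le (Nat.succ_le_of_lt hk)
    rw [hc, acoef_zero]
  · rw [hc]; rfl
  · ext k
    rcases k with _ | _ | k
    · have := hrec 0
      simp only [coeff_add, coeff_sub, coeff_C_mul, coeff_mul_X_zero, coeff_derivative, hc,
        coeff_zero, coeff_mul_X_pow']
      simp at this ⊢
      linear_combination this
    · have := hrec 1
      simp only [coeff_add, coeff_sub, coeff_C_mul, coeff_mul_X, coeff_derivative, hc,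
        coeff_zero, coeff_mul_X_pow']
      simp at this ⊢
      linear_combination this
    · have := hrec (k + 2)
      simp only [coeff_add, coeff_sub, coeff_C_mul, coeff_mul_X, coeff_derivative, hc,
        coeff_zero, coeff_mul_X_pow]
      push_cast at this ⊢
      linear_combination this

/-- For `n ≥ 2`, `m ≠ 0`, `Λ = -2m²/((n+1)(n+2))` and `ν = √(n(n+3))`, there is a nonzero
polynomial `A` of degree at most `n+1` such that
`g(t) = cosh(t/√2)^(-ν)·(1+tanh(t/√2))^(-ν)·A(tanh(t/√2))` is a nonzero solution of
`g'' = -(1 + (m²/Λ)·tanh²(t/√2))·g = (-1 + ((n+1)(n+2)/2)·tanh²(t/√2))·g`. -/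
theorem stmt_6 (n : ℕ) (hn : 2 ≤ n) (m : ℝ) (hm : m ≠ 0)
    (Λ ν : ℝ) (hΛ : Λ = -2 * m ^ 2 / ((n + 1) * (n + 2)))
    (hν : ν = Real.sqrt (n * (n + 3))) :
    ∃ A : Polynomial ℂ, A ≠ 0 ∧ A.natDegree ≤ n + 1 ∧
      ∀ g : ℝ → ℂ,
        (∀ t : ℝ, g t =
          (((Real.cosh (t / Real.sqrt 2)) ^ (-ν) *
            (1 + Real.tanh (t / Real.sqrt 2)) ^ (-ν) : ℝ) : ℂ) *
            A.eval ((Real.tanh (t / Real.sqrt 2) : ℝ) : ℂ)) →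
        (g ≠ 0 ∧
          ∀ t : ℝ, deriv (deriv g) t =
            ((-(1 + (m ^ 2 / Λ) * Real.tanh (t / Real.sqrt 2) ^ 2) : ℝ) : ℂ) * g t ∧
            deriv (deriv g) t =
              ((-1 + ((n + 1) * (n + 2) / 2 : ℝ) * Real.tanh (t / Real.sqrt 2) ^ 2 : ℝ) : ℂ) *
                g t) := by
  have hν0 : 0 ≤ ν := hν ▸ Real.sqrt_nonneg _
  have hν2 : ν ^ 2 = n * (n + 3) := by rw [hν, Real.sq_sqrt (by positivity)]
  obtain ⟨B, hBd, hB0, hBode⟩ := exists_B ν hν0 (n + 1)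
  have hA1 : (B.comp (1 - Polynomial.X)).eval 1 = 1 := by
    simp [Polynomial.eval_comp, ← hB0, Polynomial.coeff_zero_eq_eval_zero]
  have hA0 : B.comp (1 - Polynomial.X) ≠ 0 := by
    intro h; rw [h] at hA1; simp at hA1
  refine ⟨B.comp (1 - Polynomial.X), hA0, ?_, ?_⟩
  · refine Polynomial.natDegree_comp_le.trans ?_
    have : (1 - Polynomial.X : Polynomial ℂ).natDegree ≤ 1 := by
      refine (Polynomial.natDegree_sub_le _ _).trans ?_
      simp
    calc _ ≤ (n + 1) * 1 := Nat.mul_le_mul hBd this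
      _ = _ := mul_one _
  intro g hg
  set A := B.comp (1 - Polynomial.X) with hAdef
  have hpre : ∀ s : ℝ, Real.cosh s ^ (-ν) * (1 + Real.tanh s) ^ (-ν) = Real.exp (-ν * s) := by
    intro s
    have hc := Real.cosh_pos s
    have e : Real.cosh s * (1 + Real.tanh s) = Real.exp s := by
      rw [Real.tanh_eq_sinh_div_cosh, ← Real.cosh_add_sinh]
      field_simp
    have hp : 0 < 1 + Real.tanh s := by
      have := Real.exp_pos s
      rw [← e] at this
      exact (pos_iff_pos_of_mul_pos this).mp hc
    rw [← Real.mul_rpow hc.le hp.le, e, ← Real.exp_mul, mul_comm]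
  have hg' : g = fun t : ℝ => ((Real.exp (-ν * (t / √2)) : ℝ) : ℂ) *
        A.eval ((Real.tanh (t / √2) : ℝ) : ℂ) := by
    funext t; rw [hg, hpre]
  have h2 : (0 : ℝ) < √2 := by positivity
  refine ⟨?_, ?_⟩
  · intro h0
    apply hA0
    refine Polynomial.eq_zero_of_infinite_isRoot _ ?_
    refine Set.Infinite.mono (s := Set.range fun s : ℝ => ((Real.tanh s : ℝ) : ℂ)) ?_ ?_
    · rintro _ ⟨s, rfl⟩
      have := congrFun hg' (s * √2)
      rw [h0] at this
      simp only [Pi.zero_apply, mul_div_cancel_right₀ _ h2.ne'] at this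
      rcases mul_eq_zero.mp this.symm with h | h
      · exact absurd (Complex.ofReal_eq_zero.mp h) (Real.exp_pos _).ne'
      · exact h
    · exact Set.infinite_range_of_injective (Complex.ofReal_injective.comp Real.tanh_injective)
  have key : ∀ t : ℝ, deriv (deriv g) t =
              ((-1 + ((n + 1) * (n + 2) / 2 : ℝ) * Real.tanh (t / Real.sqrt 2) ^ 2 : ℝ) : ℂ) *
                g t := by
    intro t
    rw [hg', funext fun t => (hderiv_aux ν A t).deriv, (hderiv_aux ν _ t).deriv]
    have hs : ((√2 : ℝ) : ℂ)⁻¹ * ((√2 : ℝ) : ℂ)⁻¹ = 1 / 2 := by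
      rw [← mul_inv, ← Complex.ofReal_mul, Real.mul_self_sqrt (by norm_num)]; norm_num
    have hode := congrArg (Polynomial.eval (1 - ((Real.tanh (t / √2) : ℝ) : ℂ))) hBode
    have hνc : (ν : ℂ) ^ 2 = n * (n + 3) := by exact_mod_cast hν2
    beta_reduce
    generalize Real.tanh (t / √2) = x at *
    simp [hAdef, Polynomial.eval_comp, Polynomial.derivative_comp] at hode ⊢
    generalize Polynomial.eval (1 - (x : ℂ)) B = b0 at *
    generalize Polynomial.eval (1 - (x : ℂ)) (Polynomial.derivative B) = b1 at *
    generalize Polynomial.eval (1 - (x : ℂ)) (Polynomial.derivative (Polynomial.derivative B)) = b2 at *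
    generalize Complex.exp (-((ν : ℂ) * (t / ((√2 : ℝ) : ℂ)))) = E at *
    generalize (((√2 : ℝ) : ℂ))⁻¹ = r at *
    linear_combination E * ((ν : ℂ) ^ 2 * b0 + 2 * ν * (1 - (x : ℂ) ^ 2) * b1
      + (1 - (x : ℂ) ^ 2) * ((1 - (x : ℂ) ^ 2) * b2 + 2 * x * b1)) * hs
      + E * (1 - (x : ℂ) ^ 2) / 2 * hode + E * b0 / 2 * hνc
  intro t
  refine ⟨?_, key t⟩
  rw [key t]
  congr 2
  rw [hΛ]
  field_simp
  ring
end

section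
/- Let m, Λ, λ ∈ ℂ with Λ ≠ 0, λ ≠ 0 and λΛ − m⁴ ≠ 0, and let V₄(q₁,q₂) := (Λ/4)q₁⁴ − (m²/2)q₁²q₂² + (λ/4)q₂⁴. Then for every (c₁,c₂) ∈ ℂ² with (c₁,c₂) ≠ (0,0), the Darboux-point equations Λc₁³ − m²c₁c₂² = c₁ and λc₂³ − m²c₁²c₂ = c₂ hold if and only if one of the following holds: (a) c₂ = 0 and Λc₁² = 1; (b) c₁ = 0 and λc₂² = 1; (c) c₁² = (λ + m²)/(λΛ − m⁴) and c₂² = (Λ + m²)/(λΛ − m⁴). In particular, for generic parameters the nonzero Darboux points are exactly the eight points (±Λ^(−1/2), 0), (0, ±λ^(−1/2)), (±√((λ+m²)/(λΛ−m⁴)), ±√((Λ+m²)/(λΛ−m⁴))). -/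
/-- Classification of the Darboux points of the quartic potential
`V₄ = (Λ/4)q₁⁴ - (m²/2)q₁²q₂² + (λ/4)q₂⁴`: the nonzero solutions of `∇V₄(c) = c` are exactly
those with (a) `c₂ = 0`, `Λc₁² = 1`; (b) `c₁ = 0`, `λc₂² = 1`; or
(c) `c₁² = (λ+m²)/(λΛ-m⁴)`, `c₂² = (Λ+m²)/(λΛ-m⁴)`. -/
theorem stmt_9 (m Λ lam : ℂ) (hΛ : Λ ≠ 0) (hlam : lam ≠ 0) (hD : lam * Λ - m ^ 4 ≠ 0)
    (c₁ c₂ : ℂ) (hc : (c₁, c₂) ≠ (0, 0)) :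
    (Λ * c₁ ^ 3 - m ^ 2 * c₁ * c₂ ^ 2 = c₁ ∧ lam * c₂ ^ 3 - m ^ 2 * c₁ ^ 2 * c₂ = c₂) ↔
    ((c₂ = 0 ∧ Λ * c₁ ^ 2 = 1) ∨ (c₁ = 0 ∧ lam * c₂ ^ 2 = 1) ∨
      (c₁ ^ 2 = (lam + m ^ 2) / (lam * Λ - m ^ 4) ∧
        c₂ ^ 2 = (Λ + m ^ 2) / (lam * Λ - m ^ 4))) := by
  constructor
  · rintro ⟨h1, h2⟩
    by_cases hc2 : c₂ = 0
    · have hc1 : c₁ ≠ 0 := by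
        rintro rfl
        exact hc (by rw [hc2])
      refine Or.inl ⟨hc2, ?_⟩
      apply mul_left_cancel₀ hc1
      subst hc2
      linear_combination h1
    · have e2 : lam * c₂ ^ 2 - m ^ 2 * c₁ ^ 2 = 1 := by
        apply mul_left_cancel₀ hc2
        linear_combination h2
      by_cases hc1 : c₁ = 0
      · refine Or.inr (Or.inl ⟨hc1, ?_⟩)
        subst hc1
        linear_combination e2
      · have e1 : Λ * c₁ ^ 2 - m ^ 2 * c₂ ^ 2 = 1 := by
          apply mul_left_cancel₀ hc1
          linear_combination h1
        refine Or.inr (Or.inr ⟨?_, ?_⟩)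
        · rw [eq_div_iff hD]
          linear_combination lam * e1 + m ^ 2 * e2
        · rw [eq_div_iff hD]
          linear_combination Λ * e2 + m ^ 2 * e1
  · rintro (⟨h0, h⟩ | ⟨h0, h⟩ | ⟨h1, h2⟩)
    · subst h0
      exact ⟨by linear_combination c₁ * h, by ring⟩
    · subst h0
      exact ⟨by ring, by linear_combination c₂ * h⟩
    · rw [eq_div_iff hD] at h1 h2
      constructor
      · apply mul_right_cancel₀ hD
        linear_combination c₁ * Λ * h1 - c₁ * m ^ 2 * h2
      · apply mul_right_cancel₀ hD
        linear_combination c₂ * lam * h2 - c₂ * m ^ 2 * h1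
end

section
/- Let m, Λ, λ ∈ ℂ with D := λΛ − m⁴ ≠ 0, and let (c₁,c₂) ∈ ℂ² satisfy c₁² = (λ + m²)/D and c₂² = (Λ + m²)/D (a mixed Darboux point of V₄). Then the characteristic polynomial of the Hessian matrix [[3Λc₁² − m²c₂², −2m²c₁c₂], [−2m²c₁c₂, 3λc₂² − m²c₁²]] of V₄ at (c₁,c₂) is (X − 3)(X − α) with α := (3λΛ + 2λm² + 2Λm² + m⁴)/(λΛ − m⁴); equivalently, the Hessian has trace 3 + α and determinant 3α, so its eigenvalues are 3 and α. -/
/-- At a mixed Darboux point of `V₄`, the characteristic polynomial of the Hessian is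
`(X-3)(X-α)` with `α = (3λΛ + 2λm² + 2Λm² + m⁴)/(λΛ - m⁴)`; equivalently the Hessian has
trace `3 + α` and determinant `3α`. -/
theorem stmt_11 (m Λ lam : ℂ) (hD : lam * Λ - m ^ 4 ≠ 0) (c₁ c₂ : ℂ)
    (hc₁ : c₁ ^ 2 = (lam + m ^ 2) / (lam * Λ - m ^ 4))
    (hc₂ : c₂ ^ 2 = (Λ + m ^ 2) / (lam * Λ - m ^ 4))
    (α : ℂ) (hα : α = (3 * lam * Λ + 2 * lam * m ^ 2 + 2 * Λ * m ^ 2 + m ^ 4) / (lam * Λ - m ^ 4))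
    (M : Matrix (Fin 2) (Fin 2) ℂ)
    (hM : M = !![3 * Λ * c₁ ^ 2 - m ^ 2 * c₂ ^ 2, -2 * m ^ 2 * c₁ * c₂;
                 -2 * m ^ 2 * c₁ * c₂, 3 * lam * c₂ ^ 2 - m ^ 2 * c₁ ^ 2]) :
    M.charpoly = (Polynomial.X - Polynomial.C 3) * (Polynomial.X - Polynomial.C α) ∧
    M.trace = 3 + α ∧ M.det = 3 * α := by
  have hD' : Λ * lam - m ^ 4 ≠ 0 := by rwa [mul_comm Λ lam]
  have ht : M.trace = 3 + α := by
    rw [hM, Matrix.trace_fin_two_of, hα, hc₁, hc₂]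
    field_simp
    ring
  have hd : M.det = 3 * α := by
    have h : M.det = (3 * Λ * c₁ ^ 2 - m ^ 2 * c₂ ^ 2) * (3 * lam * c₂ ^ 2 - m ^ 2 * c₁ ^ 2)
        - 4 * m ^ 4 * c₁ ^ 2 * c₂ ^ 2 := by
      rw [hM, Matrix.det_fin_two_of]
      ring
    rw [h, hα, hc₁, hc₂]
    field_simp
    ring
  refine ⟨?_, ht, hd⟩
  rw [Matrix.charpoly_fin_two, ht, hd, Polynomial.C_add, Polynomial.C_mul]
  ring
end

section
/- Let m be a nonzero real number, and define μ(n) := −2m²/((n+1)(n+2)) for n ∈ ℤ with (n+1)(n+2) ≠ 0, μ₁(p) := −72m²/((12p+1)(12p+7)), μ₂(p) := −m²/(p(2p−1)) for p ≠ 0, and μ₃(p) := −8m²/((4p+1)(4p+3)). Then: (i) for every integer p ≠ 0, μ₂(p) = μ(2p−2), so every value μ₂(p) follows the exceptional profile μ(ℤ) of the k ≠ 0 case; (ii) for all integers p and n (with (n+1)(n+2) ≠ 0), μ₁(p) ≠ μ(n) and μ₃(p) ≠ μ(n), i.e. no value of μ₁ or μ₃ lies in μ(ℤ). -/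
/-- (i) Every `μ₂(p)` (`p ≠ 0`) equals `μ(2p-2)`, hence follows the exceptional profile
`μ(ℤ)` of the `k ≠ 0` case; (ii) no value of `μ₁` or `μ₃` lies in `μ(ℤ)`. -/
theorem stmt_13 (m : ℝ) (hm : m ≠ 0)
    (μ : ℤ → ℝ) (hμ : ∀ n : ℤ, μ n = -2 * m ^ 2 / (((n : ℝ) + 1) * ((n : ℝ) + 2)))
    (μ₁ μ₂ μ₃ : ℤ → ℝ)
    (hμ₁ : ∀ p : ℤ, μ₁ p = -72 * m ^ 2 / ((12 * (p : ℝ) + 1) * (12 * (p : ℝ) + 7)))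
    (hμ₂ : ∀ p : ℤ, μ₂ p = -m ^ 2 / ((p : ℝ) * (2 * (p : ℝ) - 1)))
    (hμ₃ : ∀ p : ℤ, μ₃ p = -8 * m ^ 2 / ((4 * (p : ℝ) + 1) * (4 * (p : ℝ) + 3))) :
    (∀ p : ℤ, p ≠ 0 → μ₂ p = μ (2 * p - 2)) ∧
    (∀ p n : ℤ, (n + 1) * (n + 2) ≠ 0 → μ₁ p ≠ μ n ∧ μ₃ p ≠ μ n) := by
  refine ⟨?_, ?_⟩
  · intro p hp
    rw [hμ₂, hμ]
    have h1 : (p : ℝ) ≠ 0 := by exact_mod_cast hp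
    have h2 : (2 * (p : ℝ) - 1) ≠ 0 := by
      have : (2 * p - 1 : ℤ) ≠ 0 := by omega
      exact_mod_cast this
    have e : ((((2 * p - 2 : ℤ) : ℝ) + 1) * (((2 * p - 2 : ℤ) : ℝ) + 2))
        = 2 * ((p : ℝ) * (2 * (p : ℝ) - 1)) := by push_cast; ring
    rw [e]
    rw [div_eq_div_iff (mul_ne_zero h1 h2) (mul_ne_zero two_ne_zero (mul_ne_zero h1 h2))]
    ring
  · intro p n hn
    have hn' : (((n : ℝ) + 1) * ((n : ℝ) + 2)) ≠ 0 := by exact_mod_cast hn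
    have hm2 : m ^ 2 ≠ 0 := pow_ne_zero 2 hm
    constructor
    · intro h
      rw [hμ₁, hμ] at h
      have h1 : ((12 * (p : ℝ) + 1) * (12 * (p : ℝ) + 7)) ≠ 0 := by
        have : ((12 * p + 1) * (12 * p + 7) : ℤ) ≠ 0 :=
          mul_ne_zero (by omega) (by omega)
        exact_mod_cast this
      rw [div_eq_div_iff h1 hn'] at h
      have h3 : 36 * (((n : ℝ) + 1) * ((n : ℝ) + 2))
          = (12 * (p : ℝ) + 1) * (12 * (p : ℝ) + 7) := by
        apply mul_left_cancel₀ hm2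
        linarith
      have h4 : 36 * ((n + 1) * (n + 2)) = (12 * p + 1) * (12 * p + 7) := by
        exact_mod_cast h3
      have h5 : (12 * p + 1) * (12 * p + 7) = 2 * (72 * (p * p) + 48 * p + 3) + 1 := by ring
      omega
    · intro h
      rw [hμ₃, hμ] at h
      have h1 : ((4 * (p : ℝ) + 1) * (4 * (p : ℝ) + 3)) ≠ 0 := by
        have : ((4 * p + 1) * (4 * p + 3) : ℤ) ≠ 0 :=
          mul_ne_zero (by omega) (by omega)
        exact_mod_cast this
      rw [div_eq_div_iff h1 hn'] at h
      have h3 : 4 * (((n : ℝ) + 1) * ((n : ℝ) + 2))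
          = (4 * (p : ℝ) + 1) * (4 * (p : ℝ) + 3) := by
        apply mul_left_cancel₀ hm2
        linarith
      have h4 : 4 * ((n + 1) * (n + 2)) = (4 * p + 1) * (4 * p + 3) := by
        exact_mod_cast h3
      have h5 : (4 * p + 1) * (4 * p + 3) = 2 * (8 * (p * p) + 8 * p + 1) + 1 := by ring
      omega
end

section
/- Let m be a nonzero real number, μ₁(p) := −72m²/((12p+1)(12p+7)) and μ₃(p) := −8m²/((4p+1)(4p+3)), and α(Λ,λ) := (3λΛ + 2λm² + 2Λm² + m⁴)/(λΛ − m⁴). Then for all integers p, q: (i) with Λ = μ₁(p) and λ = μ₁(q) (assuming λΛ ≠ m⁴), α(Λ,λ) ∉ S₁ ∪ S₂ ∪ S₃; (ii) with Λ = μ₃(p) and λ = μ₃(q) (assuming λΛ ≠ m⁴), α(Λ,λ) ∉ S₁ ∪ S₂ ∪ S₃. That is, the values R₁,₁(p,q) and R₃,₃(p,q) never belong to the Morales–Ramis table sets. -/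
theorem key_aux (m k A B x : ℝ) (hm : m ≠ 0) (hA : A ≠ 0) (hB : B ≠ 0)
    (L l : ℝ) (hL : L = -k * m ^ 2 / A) (hl : l = -k * m ^ 2 / B) (hne : l * L ≠ m ^ 4)
    (h : (3 * l * L + 2 * l * m ^ 2 + 2 * L * m ^ 2 + m ^ 4) / (l * L - m ^ 4) = x) :
    x * (k ^ 2 - A * B) = 3 * k ^ 2 - 2 * k * (A + B) + A * B := by
  rw [div_eq_iff (sub_ne_zero.2 hne)] at h
  have h1 : L * A = -k * m ^ 2 := by rw [hL]; field_simp
  have h2 : l * B = -k * m ^ 2 := by rw [hl]; field_simp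
  have h3 : (l * L) * (A * B) = k ^ 2 * m ^ 4 := by
    linear_combination (l * B) * h1 - k * m ^ 2 * h2
  have hm4 : m ^ 4 ≠ 0 := pow_ne_zero _ hm
  apply mul_left_cancel₀ hm4
  linear_combination (-(A * B)) * h + (3 - x) * h3 + 2 * m ^ 2 * A * h2 + 2 * m ^ 2 * B * h1

theorem odd_aux (c d e P : ℤ) (hc : Odd c) (hP : Odd P) (hd : Even d) (h : c * P = d * e) :
    False := by
  have h1 := hc.mul hP
  rw [h] at h1
  exact (Int.not_even_iff_odd.2 h1) (hd.mul_right e)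

theorem int_one (r a b : ℤ) (s t : ℤ) (ha : a = 48 * s + 7) (hb : b = 48 * t + 7)
    (h : r * (2 * r - 1) * (72 ^ 2 - a * b) = 3 * 72 ^ 2 - 2 * 72 * (a + b) + a * b) : False := by
  obtain ⟨v, hv | hv | hv⟩ : ∃ v : ℤ, r = 3 * v ∨ r = 3 * v + 1 ∨ r = 3 * v + 2 :=
    ⟨r / 3, by omega⟩
  all_goals
    subst hv ha hb
    ring_nf at h
    omega

theorem int_three (r a b s t : ℤ) (ha : a = 32 * s + 3) (hb : b = 32 * t + 3)
    (hs : 0 ≤ s) (ht : 0 ≤ t)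
    (h : r * (2 * r - 1) * (8 ^ 2 - a * b) = 3 * 8 ^ 2 - 2 * 8 * (a + b) + a * b) : False := by
  obtain ⟨N, hN⟩ : ∃ N, N = r * (2 * r - 1) + 1 := ⟨_, rfl⟩
  have hpos : 0 < N := by nlinarith [sq_nonneg (4 * r - 1)]
  have e : N * (a * b - 64) = 16 * (a + b - 16) := by rw [hN]; linear_combination -h
  have hdv : (32 : ℤ) ∣ N := by
    have : 9 * N = 32 * ((2 * N + 16 * (s + t) - 5) - N * (32 * s * t + 3 * s + 3 * t)) := by
      subst ha hb
      linear_combination e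
    omega
  have hN32 : 32 ≤ N := Int.le_of_dvd hpos hdv
  have hst : 0 ≤ s * t := mul_nonneg hs ht
  have hab : a * b = 1024 * (s * t) + 96 * s + 96 * t + 9 := by subst ha hb; ring
  by_cases h0 : s + t = 0
  · have h1 : s = 0 := by omega
    have h2 : t = 0 := by omega
    subst h1 h2 ha hb
    omega
  · have : 1 ≤ s + t := by omega
    nlinarith

/-- The values `R₁,₁(p,q) = α(μ₁(p), μ₁(q))` and `R₃,₃(p,q) = α(μ₃(p), μ₃(q))` never belong to
the Morales–Ramis table sets `S₁ ∪ S₂ ∪ S₃`. -/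
theorem stmt_16 (m : ℝ) (hm : m ≠ 0)
    (μ₁ μ₃ : ℤ → ℝ)
    (hμ₁ : ∀ p : ℤ, μ₁ p = -72 * m ^ 2 / ((12 * (p : ℝ) + 1) * (12 * (p : ℝ) + 7)))
    (hμ₃ : ∀ p : ℤ, μ₃ p = -8 * m ^ 2 / ((4 * (p : ℝ) + 1) * (4 * (p : ℝ) + 3)))
    (α : ℝ → ℝ → ℝ)
    (hα : ∀ Λ lam : ℝ, α Λ lam =
      (3 * lam * Λ + 2 * lam * m ^ 2 + 2 * Λ * m ^ 2 + m ^ 4) / (lam * Λ - m ^ 4)) :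
    ∀ p q : ℤ,
      (μ₁ q * μ₁ p ≠ m ^ 4 →
        α (μ₁ p) (μ₁ q) ∉
          ({x : ℝ | ∃ r : ℤ, x = (1 + 12 * (r : ℝ)) * (7 + 12 * (r : ℝ)) / 72} ∪
           {x : ℝ | ∃ r : ℤ, x = (r : ℝ) * (2 * (r : ℝ) - 1)} ∪
           {x : ℝ | ∃ r : ℤ, x = (1 + 4 * (r : ℝ)) * (3 + 4 * (r : ℝ)) / 8})) ∧
      (μ₃ q * μ₃ p ≠ m ^ 4 →
        α (μ₃ p) (μ₃ q) ∉
          ({x : ℝ | ∃ r : ℤ, x = (1 + 12 * (r : ℝ)) * (7 + 12 * (r : ℝ)) / 72} ∪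
           {x : ℝ | ∃ r : ℤ, x = (r : ℝ) * (2 * (r : ℝ) - 1)} ∪
           {x : ℝ | ∃ r : ℤ, x = (1 + 4 * (r : ℝ)) * (3 + 4 * (r : ℝ)) / 8})) := by
  have odd1 : ∀ p : ℤ, Odd ((12 * p + 1) * (12 * p + 7)) := fun p =>
    Odd.mul ⟨6 * p, by ring⟩ ⟨6 * p + 3, by ring⟩
  have odd3 : ∀ p : ℤ, Odd ((4 * p + 1) * (4 * p + 3)) := fun p =>
    Odd.mul ⟨2 * p, by ring⟩ ⟨2 * p + 1, by ring⟩
  have nz : ∀ a : ℤ, Odd a → (a : ℝ) ≠ 0 := by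
    intro a ha h
    have : a = 0 := by exact_mod_cast h
    subst this
    exact absurd ha (by decide)
  have oddP : ∀ k a b : ℤ, Even k → Odd a → Odd b → Odd (k ^ 2 - a * b) := by
    intro k a b hk ha hb
    exact Even.sub_odd (hk.pow_of_ne_zero two_ne_zero) (ha.mul hb)
  intro p q
  constructor
  · intro hne hmem
    rw [hα] at hmem
    have key := fun x => key_aux m 72 (((12 * p + 1) * (12 * p + 7) : ℤ) : ℝ) (((12 * q + 1) * (12 * q + 7) : ℤ) : ℝ) x hm
      (nz _ (odd1 p)) (nz _ (odd1 q)) (μ₁ p) (μ₁ q)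
      (by rw [hμ₁ p]; push_cast; ring) (by rw [hμ₁ q]; push_cast; ring) hne
    have hP := oddP 72 _ _ (by decide) (odd1 p) (odd1 q)
    obtain (⟨r, hr⟩ | ⟨r, hr⟩) | ⟨r, hr⟩ := hmem
    · have h := key _ hr
      refine odd_aux ((12 * r + 1) * (12 * r + 7)) 72 (15552 - 144 * (((12 * p + 1) * (12 * p + 7) : ℤ) + ((12 * q + 1) * (12 * q + 7) : ℤ)) + ((12 * p + 1) * (12 * p + 7) : ℤ) * ((12 * q + 1) * (12 * q + 7) : ℤ)) _ (odd1 r) hP (by decide) ?_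
      have h' := congrArg (fun y : ℝ => 72 * y) h
      push_cast at h'
      rify
      linear_combination h'
    · have h := key _ hr
      refine int_one r (a := ((12 * p + 1) * (12 * p + 7) : ℤ)) (b := ((12 * q + 1) * (12 * q + 7) : ℤ)) (3 * p ^ 2 + 2 * p) (3 * q ^ 2 + 2 * q) (by ring) (by ring) ?_
      exact_mod_cast h
    · have h := key _ hr
      refine odd_aux ((4 * r + 1) * (4 * r + 3)) 8 (15552 - 144 * (((12 * p + 1) * (12 * p + 7) : ℤ) + ((12 * q + 1) * (12 * q + 7) : ℤ)) + ((12 * p + 1) * (12 * p + 7) : ℤ) * ((12 * q + 1) * (12 * q + 7) : ℤ)) _ (odd3 r) hP (by decide) ?_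
      have h' := congrArg (fun y : ℝ => 8 * y) h
      push_cast at h'
      rify
      linear_combination h'
  · intro hne hmem
    rw [hα] at hmem
    have key := fun x => key_aux m 8 (((4 * p + 1) * (4 * p + 3) : ℤ) : ℝ) (((4 * q + 1) * (4 * q + 3) : ℤ) : ℝ) x hm
      (nz _ (odd3 p)) (nz _ (odd3 q)) (μ₃ p) (μ₃ q)
      (by rw [hμ₃ p]; push_cast; ring) (by rw [hμ₃ q]; push_cast; ring) hne
    have hP := oddP 8 _ _ (by decide) (odd3 p) (odd3 q)
    obtain (⟨r, hr⟩ | ⟨r, hr⟩) | ⟨r, hr⟩ := hmem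
    · have h := key _ hr
      refine odd_aux ((12 * r + 1) * (12 * r + 7)) 72 (192 - 16 * (((4 * p + 1) * (4 * p + 3) : ℤ) + ((4 * q + 1) * (4 * q + 3) : ℤ)) + ((4 * p + 1) * (4 * p + 3) : ℤ) * ((4 * q + 1) * (4 * q + 3) : ℤ)) _ (odd1 r) hP (by decide) ?_
      have h' := congrArg (fun y : ℝ => 72 * y) h
      push_cast at h'
      rify
      linear_combination h'
    · have h := key _ hr
      have tri : ∀ p : ℤ, ∃ s : ℤ, 0 ≤ s ∧ (4 * p + 1) * (4 * p + 3) = 32 * s + 3 := by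
        intro p
        obtain ⟨s, hs⟩ := Int.even_mul_succ_self p
        refine ⟨s, ?_, by linear_combination 16 * hs⟩
        by_contra hlt
        have h1 : p * (p + 1) < 0 := by omega
        rcases le_or_gt 0 p with h2 | h2
        · nlinarith
        · nlinarith
      obtain ⟨s, hs, hs'⟩ := tri p
      obtain ⟨t, ht, ht'⟩ := tri q
      refine int_three r _ _ s t hs' ht' hs ht ?_
      exact_mod_cast h
    · have h := key _ hr
      refine odd_aux ((4 * r + 1) * (4 * r + 3)) 8 (192 - 16 * (((4 * p + 1) * (4 * p + 3) : ℤ) + ((4 * q + 1) * (4 * q + 3) : ℤ)) + ((4 * p + 1) * (4 * p + 3) : ℤ) * ((4 * q + 1) * (4 * q + 3) : ℤ)) _ (odd3 r) hP (by decide) ?_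
      have h' := congrArg (fun y : ℝ => 8 * y) h
      push_cast at h'
      rify
      linear_combination h'
end
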